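/- The lattices M and M' are isometric: there exists a ℤ-linear bijection F : M → M' with ⟨F(u),F(v)⟩' = ⟨u,v⟩ for all u,v ∈ M. (This shows that the lattice generated inside H²(Ỹ,ℤ) by the exceptional classes n̄_1,...,n̄_4, m_1,...,m_8 together with μ_1 and μ_2 is a copy of Nikulin's exceptional lattice M_{(ℤ/2ℤ)²}.) -/

import Mathlib

/- Context: V = ℚ^12 with coordinates (m₁,…,m₈,n₁,…,n₄) and V' = ℚ^12 with
coordinates (u₁,…,u₁₂), both with Gram matrix -2·Id; M the lattice generated
by the standard basis together with μ₁, μ₂; M' Nikulin's exceptional lattice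
M_{(ℤ/2ℤ)²}. -/

noncomputable section
open Matrix

abbrev V : Type := Fin 12 → ℚ

def B (u v : V) : ℚ := -2 * (u ⬝ᵥ v)

def bv : Fin 12 → V := fun i j => if i = j then 1 else 0

/-- μ₁ = (m₁+⋯+m₈)/2 -/
def μ₁ : V := (1/2 : ℚ) • (bv 0 + bv 1 + bv 2 + bv 3 + bv 4 + bv 5 + bv 6 + bv 7)
/-- μ₂ = (n₁+n₂+n₃+n₄+m₁+m₂+m₇+m₈)/2 -/
def μ₂ : V := (1/2 : ℚ) • (bv 8 + bv 9 + bv 10 + bv 11 + bv 0 + bv 1 + bv 6 + bv 7)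

def M : Submodule ℤ V := Submodule.span ℤ (Set.range bv ∪ {μ₁, μ₂})

abbrev V' : Type := Fin 12 → ℚ

def B' (u v : V') : ℚ := -2 * (u ⬝ᵥ v)

def bv' : Fin 12 → V' := fun i j => if i = j then 1 else 0

/-- (u₁+⋯+u₈)/2 -/
def κ₁ : V' := (1/2 : ℚ) • (bv' 0 + bv' 1 + bv' 2 + bv' 3 + bv' 4 + bv' 5 + bv' 6 + bv' 7)
/-- (u₅+⋯+u₁₂)/2 -/
def κ₂ : V' := (1/2 : ℚ) • (bv' 4 + bv' 5 + bv' 6 + bv' 7 + bv' 8 + bv' 9 + bv' 10 + bv' 11)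

/-- Nikulin's exceptional lattice M_{(ℤ/2ℤ)²}. -/
def M' : Submodule ℤ V' := Submodule.span ℤ (Set.range bv' ∪ {κ₁, κ₂})

/-- The coordinate permutation exchanging the index sets of `μ₁`, `μ₂` with those of `κ₁`, `κ₂`. -/
def coordPerm : Equiv.Perm (Fin 12) := Equiv.swap 0 4 * Equiv.swap 1 5

/-- The permutation of coordinates as a `ℤ`-linear automorphism of `ℚ^12`. -/
def permEquiv : V ≃ₗ[ℤ] V' := LinearEquiv.funCongrLeft ℤ ℚ coordPerm

lemma permEquiv_apply (v : V) (i : Fin 12) : permEquiv v i = v (coordPerm i) := rfl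

lemma coordPerm_coordPerm (i : Fin 12) : coordPerm (coordPerm i) = i := by
  revert i; decide

lemma permEquiv_bv (i : Fin 12) : permEquiv (bv i) = bv' (coordPerm i) := by
  ext j
  have h : i = coordPerm j ↔ coordPerm i = j :=
    ⟨fun h => by rw [h, coordPerm_coordPerm], fun h => by rw [← h, coordPerm_coordPerm]⟩
  simp only [permEquiv_apply, bv, bv', h]

lemma permEquiv_smul (c : ℚ) (v : V) : permEquiv (c • v) = c • permEquiv v := rfl

lemma permEquiv_μ₁ : permEquiv μ₁ = κ₁ := by
  simp only [μ₁, κ₁, permEquiv_smul, map_add, permEquiv_bv,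
    show coordPerm 0 = 4 by decide, show coordPerm 1 = 5 by decide,
    show coordPerm 2 = 2 by decide, show coordPerm 3 = 3 by decide,
    show coordPerm 4 = 0 by decide, show coordPerm 5 = 1 by decide,
    show coordPerm 6 = 6 by decide, show coordPerm 7 = 7 by decide]
  congr 1
  abel

lemma permEquiv_μ₂ : permEquiv μ₂ = κ₂ := by
  simp only [μ₂, κ₂, permEquiv_smul, map_add, permEquiv_bv,
    show coordPerm 0 = 4 by decide, show coordPerm 1 = 5 by decide,
    show coordPerm 6 = 6 by decide, show coordPerm 7 = 7 by decide,
    show coordPerm 8 = 8 by decide, show coordPerm 9 = 9 by decide,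
    show coordPerm 10 = 10 by decide, show coordPerm 11 = 11 by decide]
  congr 1
  abel

lemma map_permEquiv_M : M.map (permEquiv : V →ₗ[ℤ] V') = M' := by
  have hrange : permEquiv '' Set.range bv = Set.range bv' := by
    rw [← Set.range_comp, ← coordPerm.surjective.range_comp bv']
    exact congrArg Set.range (funext permEquiv_bv)
  rw [M, M', Submodule.map_span, LinearEquiv.coe_coe, Set.image_union, Set.image_pair,
    permEquiv_μ₁, permEquiv_μ₂, hrange]

lemma B'_permEquiv (u v : V) : B' (permEquiv u) (permEquiv v) = B u v := by
  simp only [B, B', dotProduct, permEquiv_apply]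
  rw [Equiv.sum_comp coordPerm fun i => u i * v i]

/-- M and M' are isometric. -/
theorem stmt19 :
    ∃ F : M ≃ₗ[ℤ] M', ∀ u v : M, B' (F u : V') (F v : V') = B (u : V) (v : V) := by
  exact ⟨permEquiv.ofSubmodules M M' map_permEquiv_M, fun u v => B'_permEquiv u v⟩
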